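/- Let C = {(A_ℓ, B_ℓ) : ℓ ∈ [N]} be a set of covers with respect to an extended word equation (U₁,U₂,<). Then C is an incoherent core if and only if there exist natural numbers y_ℓ for ℓ ∈ [N] such that Σ_{ℓ∈[N]} y_ℓ · U_{B_ℓ} ⊆ Σ_{ℓ∈[N]} y_ℓ · U_{A_ℓ} in ℕ[𝒳], where either this inclusion is strict or y_ℓ > 0 for some ℓ ∈ [N] such that (A_ℓ, B_ℓ) is a strict cover. -/

import Mathlib

open scoped Classical

namespace ExtWordEq

/-- The type of (candidate) boundary orders: relations on pairs (i,j). -/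
abbrev BRel : Type := ℕ × ℕ → ℕ × ℕ → Prop

variable {X : Type*}

/-- The `i`-th side of the word equation (`i = 1` gives `U₁`, anything else `U₂`). -/
def word (U₁ U₂ : List X) (i : ℕ) : List X := if i = 1 then U₁ else U₂

/-- The variable `U_{i,j}` (1-indexed), as an optional value. -/
def letter (U₁ U₂ : List X) (b : ℕ × ℕ) : Option X := (word U₁ U₂ b.1)[b.2 - 1]?

/-- `b` is a boundary of the word equation `(U₁, U₂)`. -/
def Boundary (U₁ U₂ : List X) (b : ℕ × ℕ) : Prop :=
  (b.1 = 1 ∨ b.1 = 2) ∧ 1 ≤ b.2 ∧ b.2 ≤ (word U₁ U₂ b.1).length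

/-- `b` is a boundary of `(U₁, U₂)` or one of the conventional boundaries `(1,0)`, `(2,0)`. -/
def EBoundary (U₁ U₂ : List X) (b : ℕ × ℕ) : Prop :=
  (b.1 = 1 ∨ b.1 = 2) ∧ b.2 ≤ (word U₁ U₂ b.1).length

/-- Incomparability `a ≈ b` for a strict order. -/
def Incomp (lt : BRel) (a b : ℕ × ℕ) : Prop := ¬ lt a b ∧ ¬ lt b a

/-- `lt` is a boundary order for the word equation `(U₁, U₂)`:
a strict weak order on the boundaries (together with the conventional boundaries
`(1,0) ≈ (2,0)`), extending `(i,j) < (i,j+1)` and with `(1,m) ≈ (2,n)`. -/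
structure BoundaryOrder (U₁ U₂ : List X) (lt : BRel) : Prop where
  irrefl : ∀ a, EBoundary U₁ U₂ a → ¬ lt a a
  trans : ∀ a b c, EBoundary U₁ U₂ a → EBoundary U₁ U₂ b → EBoundary U₁ U₂ c →
    lt a b → lt b c → lt a c
  incomp_trans : ∀ a b c, EBoundary U₁ U₂ a → EBoundary U₁ U₂ b → EBoundary U₁ U₂ c →
    Incomp lt a b → Incomp lt b c → Incomp lt a c
  succ : ∀ i j : ℕ, EBoundary U₁ U₂ (i, j + 1) → lt (i, j) (i, j + 1)
  top : Incomp lt (1, U₁.length) (2, U₂.length)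
  bot : Incomp lt (1, 0) (2, 0)

/-- `L(U_{i,1} U_{i,2} ⋯ U_{i,j})` where `L` is the additive extension of a length
assignment on variables. -/
def prefixLen (U₁ U₂ : List X) (L : X → ℕ) (b : ℕ × ℕ) : ℕ :=
  (((word U₁ U₂ b.1).take b.2).map L).sum

/-- The extended word equation `(U₁, U₂, lt)` is coherent. -/
def Coherent (U₁ U₂ : List X) (lt : BRel) : Prop :=
  ∃ L : X → ℕ, (∀ x, 0 < L x) ∧
    ∀ a b, Boundary U₁ U₂ a → Boundary U₁ U₂ b →
      (lt a b ↔ prefixLen U₁ U₂ L a < prefixLen U₁ U₂ L b)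

/-- The boundary `a` cuts the boundary `b`. -/
def Cuts (U₁ U₂ : List X) (lt : BRel) (a b : ℕ × ℕ) : Prop :=
  Boundary U₁ U₂ a ∧ Boundary U₁ U₂ b ∧ a ≠ b ∧
    lt (a.1, a.2 - 1) b ∧ lt (b.1, b.2 - 1) a

/-- The boundary `a` mirrors the boundary `b`. -/
def Mirrors (U₁ U₂ : List X) (lt : BRel) (a b : ℕ × ℕ) : Prop :=
  Boundary U₁ U₂ a ∧ Boundary U₁ U₂ b ∧ letter U₁ U₂ a = letter U₁ U₂ b ∧
    (¬ Incomp lt a b ∨ ¬ Incomp lt (a.1, a.2 - 1) (b.1, b.2 - 1))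

/-- Edge relation of the cut graph `G_{U₁,U₂,<}`. -/
def CutEdge (U₁ U₂ : List X) (lt : BRel) (a b : ℕ × ℕ) : Prop :=
  ∃ c, Cuts U₁ U₂ lt a c ∧ Mirrors U₁ U₂ lt c b

/-- `w 0, w 1, …, w n` is a cycle (of length `n ≥ 1`) in the cut graph. -/
def IsCycle (U₁ U₂ : List X) (lt : BRel) (n : ℕ) (w : ℕ → ℕ × ℕ) : Prop :=
  0 < n ∧ w n = w 0 ∧ ∀ k < n, CutEdge U₁ U₂ lt (w k) (w (k + 1))

/-- The cut graph `G_{U₁,U₂,<}` is acyclic. -/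
def Acyclic (U₁ U₂ : List X) (lt : BRel) : Prop :=
  ¬ ∃ n w, IsCycle U₁ U₂ lt n w

variable [DecidableEq X]

/-- Case I extended Nielsen transformation (here `x = U_{1,1}`, `y = U_{2,1}`,
and `T(y) = x`). -/
def NielsenI (U₁ U₂ : List X) (lt : BRel) (U₁' U₂' : List X) (lt' : BRel) : Prop :=
  ∃ x y : X, U₁.head? = some x ∧ U₂.head? = some y ∧
    Incomp lt (1, 1) (2, 1) ∧
    U₁' = (U₁.map fun z => if z = y then x else z).tail ∧
    U₂' = (U₂.map fun z => if z = y then x else z).tail ∧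
    BoundaryOrder U₁' U₂' lt' ∧
    ∀ a b : ℕ × ℕ, EBoundary U₁' U₂' a → EBoundary U₁' U₂' b →
      (lt' a b ↔ lt (a.1, a.2 + 1) (b.1, b.2 + 1))

/-- The substitution `T(x) = y x` (identity on other variables), applied to a word. -/
def expand (x y : X) (l : List X) : List X :=
  l.flatMap fun z => if z = x then [y, x] else [z]

/-- The map `μ(i,j) = j + #{j' ≤ j : U_{i,j'} = x} − 1` (as a map on boundaries),
where `x = U_{1,1}`. -/
def mu (U₁ U₂ : List X) (x : X) (b : ℕ × ℕ) : ℕ × ℕ :=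
  (b.1, b.2 + ((word U₁ U₂ b.1).take b.2).count x - 1)

/-- The map `ν(i,j) = j − #{j' ≤ j : U'_{i,j'} = x} + 1` (as a map on boundaries),
where `x = U_{1,1}`. -/
def nu (U₁' U₂' : List X) (x : X) (b : ℕ × ℕ) : ℕ × ℕ :=
  (b.1, b.2 - ((word U₁' U₂' b.1).take b.2).count x + 1)

/-- Membership in `B⁻ = B ∖ {(2,1)}`. -/
def Bminus (U₁ U₂ : List X) (b : ℕ × ℕ) : Prop := Boundary U₁ U₂ b ∧ b ≠ (2, 1)

/-- Membership in `B'⁻ = {(i, μ(i,j)) : (i,j) ∈ B⁻}` (`x = U_{1,1}`). -/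
def Bpminus (U₁ U₂ : List X) (x : X) (b' : ℕ × ℕ) : Prop :=
  ∃ b, Bminus U₁ U₂ b ∧ mu U₁ U₂ x b = b'

/-- Case II extended Nielsen transformation, with the heads `x = U_{1,1}`,
`y = U_{2,1}` made explicit. -/
def NielsenIIxy (U₁ U₂ : List X) (lt : BRel) (U₁' U₂' : List X) (lt' : BRel)
    (x y : X) : Prop :=
  U₁.head? = some x ∧ U₂.head? = some y ∧
  lt (2, 1) (1, 1) ∧
  U₁' = (expand x y U₁).tail ∧
  U₂' = (expand x y U₂).tail ∧
  BoundaryOrder U₁' U₂' lt' ∧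
  ∀ a b, Bpminus U₁ U₂ x a → Bpminus U₁ U₂ x b →
    (lt' a b ↔ lt (nu U₁' U₂' x a) (nu U₁' U₂' x b))

/-- Case II extended Nielsen transformation. -/
def NielsenII (U₁ U₂ : List X) (lt : BRel) (U₁' U₂' : List X) (lt' : BRel) : Prop :=
  ∃ x y : X, NielsenIIxy U₁ U₂ lt U₁' U₂' lt' x y

/-- The dual boundary order. -/
def dualRel (lt : BRel) : BRel := fun a b => lt (3 - a.1, a.2) (3 - b.1, b.2)

/-- Case III extended Nielsen transformation: case II applied to the dual,
then dualized back. -/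
def NielsenIII (U₁ U₂ : List X) (lt : BRel) (U₁' U₂' : List X) (lt' : BRel) : Prop :=
  NielsenII U₂ U₁ (dualRel lt) U₂' U₁' (dualRel lt')

/-- `(U₁', U₂', lt')` is an extended Nielsen transformation of the nontrivial coherent
extended word equation `(U₁, U₂, lt)`. -/
def ExtNielsen (U₁ U₂ : List X) (lt : BRel) (U₁' U₂' : List X) (lt' : BRel) : Prop :=
  U₁ ≠ [] ∧ U₂ ≠ [] ∧ BoundaryOrder U₁ U₂ lt ∧ Coherent U₁ U₂ lt ∧
    (NielsenI U₁ U₂ lt U₁' U₂' lt' ∨ NielsenII U₁ U₂ lt U₁' U₂' lt' ∨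
      NielsenIII U₁ U₂ lt U₁' U₂' lt')

/-- A coherent extended Nielsen transformation. -/
def CohNielsen (U₁ U₂ : List X) (lt : BRel) (U₁' U₂' : List X) (lt' : BRel) : Prop :=
  ExtNielsen U₁ U₂ lt U₁' U₂' lt' ∧ Coherent U₁' U₂' lt'

/-- `(U₁, U₂, lt)` is (strongly) terminating: there is no infinite sequence of coherent
extended Nielsen transformations starting from it. -/
def Terminating (U₁ U₂ : List X) (lt : BRel) : Prop :=
  ¬ ∃ f : ℕ → List X × List X × BRel,
    f 0 = (U₁, U₂, lt) ∧
    ∀ n, CohNielsen (f n).1 (f n).2.1 (f n).2.2 (f (n + 1)).1 (f (n + 1)).2.1 (f (n + 1)).2.2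


/-- An interval of boundaries `⟨i,[j,k]⟩ = {(i,ℓ) : j ≤ ℓ ≤ k}`. -/
structure Seg where
  i : ℕ
  j : ℕ
  k : ℕ
deriving DecidableEq

/-- `s` is a valid (possibly empty) interval of boundaries of `(U₁,U₂)`. -/
def ValidSeg (U₁ U₂ : List X) (s : Seg) : Prop :=
  (s.i = 1 ∨ s.i = 2) ∧ 1 ≤ s.j ∧ s.j ≤ s.k + 1 ∧ s.k ≤ (word U₁ U₂ s.i).length

/-- `a ≲ b`, i.e. `a < b` or `a ≈ b`. -/
def LeS (lt : BRel) (a b : ℕ × ℕ) : Prop := lt a b ∨ Incomp lt a b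

/-- `(A, B)` is a cover: `A` and `B` are intervals on opposite sides with
`(B.i, B.j−1) ≲ (A.i, A.j−1)` and `(A.i, A.k) ≲ (B.i, B.k)`. -/
def IsCover (U₁ U₂ : List X) (lt : BRel) (A B : Seg) : Prop :=
  ValidSeg U₁ U₂ A ∧ ValidSeg U₁ U₂ B ∧ A.i ≠ B.i ∧
    LeS lt (B.i, B.j - 1) (A.i, A.j - 1) ∧ LeS lt (A.i, A.k) (B.i, B.k)

/-- `(A, B)` is a strict cover: a cover for which at least one of the two defining
inequalities is strict. -/
def IsStrictCover (U₁ U₂ : List X) (lt : BRel) (A B : Seg) : Prop :=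
  IsCover U₁ U₂ lt A B ∧ (lt (B.i, B.j - 1) (A.i, A.j - 1) ∨ lt (A.i, A.k) (B.i, B.k))

/-- The list of variables `U_{i,j} U_{i,j+1} ⋯ U_{i,k}` of the interval `s`. -/
def segList (U₁ U₂ : List X) (s : Seg) : List X :=
  ((word U₁ U₂ s.i).take s.k).drop (s.j - 1)

/-- `L(U_{⟨i,[j,k]⟩})`, the value of the additive extension of `L` on an interval. -/
def segL (U₁ U₂ : List X) (L : X → ℕ) (s : Seg) : ℕ := ((segList U₁ U₂ s).map L).sum

/-- `U_{⟨i,[j,k]⟩} = Σ_{ℓ=j}^{k} U_{i,ℓ}` as an element of `ℕ[𝒳]`,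
the free commutative monoid on `X` (realized as `X →₀ ℕ`). -/
noncomputable def segSum (U₁ U₂ : List X) (s : Seg) : X →₀ ℕ :=
  ((segList U₁ U₂ s).map fun a => Finsupp.single a 1).sum

/-- A set `C` of covers is an incoherent core: the associated system of inequalities
(non-strict for covers, strict for strict covers) has no solution over `ℤ_{>0}`. -/
def IncoherentCore (U₁ U₂ : List X) (lt : BRel) (C : Set (Seg × Seg)) : Prop :=
  (∀ p ∈ C, IsCover U₁ U₂ lt p.1 p.2) ∧
  ¬ ∃ L : X → ℕ, (∀ x, 0 < L x) ∧
    (∀ p ∈ C, segL U₁ U₂ L p.1 ≤ segL U₁ U₂ L p.2) ∧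
    (∀ p ∈ C, IsStrictCover U₁ U₂ lt p.1 p.2 → segL U₁ U₂ L p.1 < segL U₁ U₂ L p.2)

/-- The boundary `b` lies in the interval `s`. -/
def InSeg (s : Seg) (b : ℕ × ℕ) : Prop := b.1 = s.i ∧ s.j ≤ b.2 ∧ b.2 ≤ s.k

/-- The cover `p` impinges on the cover `q`: `B₁ ∩ A₂ ≠ ∅`. -/
def Impinges (p q : Seg × Seg) : Prop := ∃ b, InSeg p.2 b ∧ InSeg q.1 b

/-- Boundaries `a` and `b` are twins. -/
def Twins (U₁ U₂ : List X) (lt : BRel) (a b : ℕ × ℕ) : Prop :=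
  Boundary U₁ U₂ a ∧ Boundary U₁ U₂ b ∧ letter U₁ U₂ a = letter U₁ U₂ b ∧
    a ≠ b ∧ Incomp lt a b ∧ Incomp lt (a.1, a.2 - 1) (b.1, b.2 - 1)

/-- The cover `p` is twin-free: neither of its intervals contains a twin. -/
def TwinFree (U₁ U₂ : List X) (lt : BRel) (p : Seg × Seg) : Prop :=
  (∀ a, InSeg p.1 a → ¬ ∃ b, Twins U₁ U₂ lt a b) ∧
  (∀ a, InSeg p.2 a → ¬ ∃ b, Twins U₁ U₂ lt a b)

/-- Farkas' lemma for finitely many linear functionals on a rational vector space. -/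
theorem farkas {ι W : Type*} [AddCommGroup W] [Module ℚ W] (s : Finset ι)
    (a : ι → W →ₗ[ℚ] ℚ) (c : W →ₗ[ℚ] ℚ)
    (h : ∀ x, (∀ i ∈ s, 0 ≤ a i x) → 0 ≤ c x) :
    ∃ w : ι → ℚ, (∀ i, 0 ≤ w i) ∧ c = ∑ i ∈ s, w i • a i := by
  induction s using Finset.induction_on generalizing a c with
  | empty =>
    refine ⟨0, fun _ => le_rfl, LinearMap.ext fun x => ?_⟩
    have h₁ := h x (by simp)
    have h₂ := h (-x) (by simp)
    simp only [map_neg] at h₂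
    simp only [Finset.sum_empty, LinearMap.zero_apply]
    linarith
  | insert k s hk ih =>
    by_cases hs : ∀ x, (∀ i ∈ s, 0 ≤ a i x) → 0 ≤ c x
    · obtain ⟨w, hw, rfl⟩ := ih a c hs
      refine ⟨Function.update w k 0, fun i => ?_, ?_⟩
      · by_cases hi : i = k <;> simp [hi, hw]
      · rw [Finset.sum_insert hk, Function.update_self, zero_smul, zero_add]
        refine Finset.sum_congr rfl fun i hi => ?_
        rw [Function.update_of_ne (ne_of_mem_of_not_mem hi hk)]
    · push Not at hs
      obtain ⟨z, hz, hcz⟩ := hs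
      have hkz : a k z < 0 := by
        by_contra! hn
        exact hcz.not_ge (h z (by simpa [hn] using hz))
      have key (x : W) (f : W →ₗ[ℚ] ℚ) :
          f (x - (a k x / a k z) • z) = (f - (f z / a k z) • a k) x := by
        simp
        ring
      obtain ⟨w, hw, hc⟩ := ih (fun i => a i - (a i z / a k z) • a k) (c - (c z / a k z) • a k)
        (fun x hx => by
          rw [← key]
          refine h _ fun i hi => ?_
          rcases Finset.mem_insert.1 hi with rfl | hi
          · simp [hkz.ne]
          · simpa only [key] using hx i hi)
      refine ⟨Function.update w k (c z / a k z - ∑ i ∈ s, w i * (a i z / a k z)), fun i => ?_, ?_⟩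
      · by_cases hi : i = k
        · subst hi
          rw [Function.update_self, sub_nonneg]
          refine (Finset.sum_nonpos fun j hj => ?_).trans (div_pos_of_neg_of_neg hcz hkz).le
          exact mul_nonpos_of_nonneg_of_nonpos (hw j)
            (div_nonpos_of_nonneg_of_nonpos (hz j hj) hkz.le)
        · simp [hi, hw]
      · have hsum : ∑ i ∈ s, Function.update w k
            (c z / a k z - ∑ i ∈ s, w i * (a i z / a k z)) i • a i = ∑ i ∈ s, w i • a i :=
          Finset.sum_congr rfl fun i hi => by
            rw [Function.update_of_ne (ne_of_mem_of_not_mem hi hk)]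
        rw [Finset.sum_insert hk, Function.update_self, hsum]
        refine (eq_add_of_sub_eq hc).trans ?_
        simp only [smul_sub, smul_smul, Finset.sum_sub_distrib, sub_smul, Finset.sum_smul]
        abel

/-- Motzkin's transposition theorem for homogeneous systems of weak and strict inequalities. -/
theorem motzkin {ι W : Type*} [Fintype ι] [AddCommGroup W] [Module ℚ W]
    (a : ι → W →ₗ[ℚ] ℚ) (strict : ι → Prop)
    (h : ¬ ∃ x, (∀ i, 0 ≤ a i x) ∧ ∀ i, strict i → 0 < a i x) :
    ∃ w : ι → ℚ, (∀ i, 0 ≤ w i) ∧ (∃ i, strict i ∧ 0 < w i) ∧ ∑ i, w i • a i = 0 := by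
  by_cases hs : ∀ i, strict i → ∃ x, (∀ j, 0 ≤ a j x) ∧ 0 < a i x
  · choose! x hx hpos using hs
    refine absurd ⟨∑ i with strict i, x i, fun j => ?_, fun j hj => ?_⟩ h
    · rw [map_sum]
      exact Finset.sum_nonneg fun i hi => hx i (Finset.mem_filter.1 hi).2 j
    · rw [map_sum]
      exact Finset.sum_pos' (fun i hi => hx i (Finset.mem_filter.1 hi).2 j)
        ⟨j, by simpa using hj, hpos j hj⟩
  · push Not at hs
    obtain ⟨k, hk, hle⟩ := hs
    obtain ⟨w, hw, hc⟩ := farkas Finset.univ a (-a k)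
      fun x hx => by simpa using hle x fun j => hx j (Finset.mem_univ j)
    refine ⟨w + Pi.single k 1, fun i => ?_, ⟨k, hk, ?_⟩, ?_⟩
    · exact add_nonneg (hw i) (by by_cases hi : i = k <;> simp [hi])
    · simpa using add_pos_of_nonneg_of_pos (hw k) one_pos
    · simp [add_smul, Finset.sum_add_distrib, ← hc, Pi.single_apply, ite_smul]

theorem exists_nat_clear_denominators {ι : Type*} (s : Finset ι) (w : ι → ℚ)
    (hw : ∀ i ∈ s, 0 ≤ w i) :
    ∃ (d : ℕ) (y : ι → ℕ), 0 < d ∧ ∀ i ∈ s, (y i : ℚ) = d * w i := by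
  refine ⟨∏ i ∈ s, (w i).den, fun i => (w i).num.toNat * ∏ j ∈ s.erase i, (w j).den,
    Finset.prod_pos fun i _ => (w i).pos, fun i hi => ?_⟩
  have hnum : (((w i).num.toNat : ℤ) : ℚ) = (w i).num := by
    rw [Int.toNat_of_nonneg (Rat.num_nonneg.2 (hw i hi))]
  rw [← Finset.mul_prod_erase s _ hi]
  push_cast at hnum ⊢
  rw [hnum]
  nth_rewrite 3 [← Rat.num_div_den (w i)]
  have : ((w i).den : ℚ) ≠ 0 := by simp
  field_simp

/-- Motzkin's transposition theorem with natural number coefficients. -/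
theorem motzkin_nat {ι W : Type*} [Fintype ι] [AddCommGroup W] [Module ℚ W]
    (a : ι → W →ₗ[ℚ] ℚ) (strict : ι → Prop)
    (h : ¬ ∃ x, (∀ i, 0 ≤ a i x) ∧ ∀ i, strict i → 0 < a i x) :
    ∃ y : ι → ℕ, (∃ i, strict i ∧ 0 < y i) ∧ ∑ i, y i • a i = 0 := by
  obtain ⟨w, hw, ⟨k, hk, hwk⟩, hsum⟩ := motzkin a strict h
  obtain ⟨d, y, hd, hy⟩ := exists_nat_clear_denominators Finset.univ w fun i _ => hw i
  refine ⟨y, ⟨k, hk, ?_⟩, ?_⟩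
  · have : (0 : ℚ) < y k := by
      rw [hy k (Finset.mem_univ k)]
      positivity
    exact_mod_cast this
  · rw [← smul_zero (d : ℚ), ← hsum, Finset.smul_sum]
    refine Finset.sum_congr rfl fun i hi => ?_
    rw [← Nat.cast_smul_eq_nsmul ℚ, hy i hi, mul_smul]

theorem injective_linearCombination_proj (X : Type*) :
    Function.Injective (Finsupp.linearCombination ℕ
      (fun x => (LinearMap.proj x : (X → ℚ) →ₗ[ℚ] ℚ))) := by
  have key (f : X →₀ ℕ) (x : X) : Finsupp.linearCombination ℕ
      (fun x => (LinearMap.proj x : (X → ℚ) →ₗ[ℚ] ℚ)) f (Pi.single x 1) = f x := by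
    by_cases hx : f x = 0 <;>
      simp [Finsupp.linearCombination_apply, Finsupp.sum, LinearMap.sum_apply,
        Pi.single_apply, hx]
  intro f g hfg
  ext x
  have hx := LinearMap.congr_fun hfg (Pi.single x 1)
  rw [key, key] at hx
  exact_mod_cast hx

theorem cast_linearCombination_eq_mul {X : Type*} (d : ℕ) (L : X → ℕ) (v : X → ℚ) (f : X →₀ ℕ)
    (h : ∀ x ∈ f.support, (L x : ℚ) = d * v x) :
    ((Finsupp.linearCombination ℕ L f : ℕ) : ℚ) =
      d * Finsupp.linearCombination ℕ (fun x => (LinearMap.proj x : (X → ℚ) →ₗ[ℚ] ℚ)) f v := by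
  simp only [Finsupp.linearCombination_apply, Finsupp.sum, LinearMap.sum_apply, Nat.cast_sum,
    Finset.mul_sum]
  refine Finset.sum_congr rfl fun x hx => ?_
  simp [h x hx]
  ring

theorem not_exists_linearCombination_le_iff {ι X : Type*} [Fintype ι] (a b : ι → X →₀ ℕ)
    (strict : ι → Prop) :
    (¬ ∃ L : X → ℕ, (∀ x, 0 < L x) ∧
      (∀ i, Finsupp.linearCombination ℕ L (a i) ≤ Finsupp.linearCombination ℕ L (b i)) ∧
      ∀ i, strict i →
        Finsupp.linearCombination ℕ L (a i) < Finsupp.linearCombination ℕ L (b i)) ↔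
    ∃ y : ι → ℕ, ∑ i, y i • b i ≤ ∑ i, y i • a i ∧
      (∑ i, y i • b i ≠ ∑ i, y i • a i ∨ ∃ i, 0 < y i ∧ strict i) := by
  constructor
  · intro h
    let T : Finset X := Finset.univ.biUnion fun i => (a i).support ∪ (b i).support
    have haT (i : ι) : (a i).support ⊆ T := fun x hx =>
      Finset.mem_biUnion.2 ⟨i, Finset.mem_univ i, Finset.mem_union_left _ hx⟩
    have hbT (i : ι) : (b i).support ⊆ T := fun x hx =>
      Finset.mem_biUnion.2 ⟨i, Finset.mem_univ i, Finset.mem_union_right _ hx⟩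
    let φ := Finsupp.linearCombination ℕ (fun x => (LinearMap.proj x : (X → ℚ) →ₗ[ℚ] ℚ))
    obtain ⟨y, hpos, hsum⟩ := motzkin_nat
      (Sum.elim (fun i => φ (b i) - φ (a i)) fun x : T => LinearMap.proj (x : X))
      (Sum.elim strict fun _ => True) (by
        rintro ⟨v, hle, hlt⟩
        have hv (x : X) (hx : x ∈ T) : 0 < v x := hlt (Sum.inr ⟨x, hx⟩) trivial
        obtain ⟨d, u, hd, hu⟩ := exists_nat_clear_denominators T v fun x hx => (hv x hx).le
        have hd' : (0 : ℚ) < d := by exact_mod_cast hd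
        have hL (f : X →₀ ℕ) (hf : f.support ⊆ T) :
            ((Finsupp.linearCombination ℕ (fun x => if x ∈ T then u x else 1) f : ℕ) : ℚ) =
              d * φ f v :=
          cast_linearCombination_eq_mul d _ v f fun x hx => by rw [if_pos (hf hx), hu x (hf hx)]
        refine h ⟨fun x => if x ∈ T then u x else 1, fun x => ?_, fun i => ?_, fun i hi => ?_⟩
        · dsimp only
          split_ifs with hx
          · have : (0 : ℚ) < u x := by
              rw [hu x hx]
              exact mul_pos hd' (hv x hx)
            exact_mod_cast this
          · exact one_pos
        · rw [← Nat.cast_le (α := ℚ), hL _ (haT i), hL _ (hbT i)]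
          exact mul_le_mul_of_nonneg_left (sub_nonneg.1 (hle (Sum.inl i))) hd'.le
        · rw [← Nat.cast_lt (α := ℚ), hL _ (haT i), hL _ (hbT i)]
          exact mul_lt_mul_of_pos_left (sub_pos.1 (hlt (Sum.inl i) hi)) hd')
    let z : X →₀ ℕ := ∑ x : T, y (Sum.inr x) • Finsupp.single (x : X) 1
    have heq : ∑ i, y (Sum.inl i) • b i + z = ∑ i, y (Sum.inl i) • a i := by
      apply injective_linearCombination_proj X
      rw [Fintype.sum_sum_type] at hsum
      simp only [Sum.elim_inl, Sum.elim_inr, smul_sub, Finset.sum_sub_distrib] at hsum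
      simp only [z, map_add, map_sum, map_nsmul, Finsupp.linearCombination_single, one_smul]
      rw [← sub_eq_zero, ← hsum]
      simp only [φ]
      abel
    refine ⟨fun i => y (Sum.inl i), heq ▸ le_self_add, ?_⟩
    obtain ⟨i | x, hi, hyi⟩ := hpos
    · exact Or.inr ⟨i, hyi, hi⟩
    · refine Or.inl fun hne => hyi.ne' ?_
      have hz : z = 0 := by simpa [hne] using heq
      exact (by simpa using (Finset.sum_eq_zero_iff.1 hz) x (Finset.mem_univ x))
  · rintro ⟨y, hle, hstrict⟩ ⟨L, hL, hab, hab'⟩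
    obtain ⟨z, hz⟩ := exists_add_of_le hle
    have hsum := congrArg (Finsupp.linearCombination ℕ L) hz
    simp only [map_add, map_sum, map_nsmul] at hsum
    have hle' (i : ι) : y i • Finsupp.linearCombination ℕ L (a i) ≤
        y i • Finsupp.linearCombination ℕ L (b i) := Nat.mul_le_mul_left _ (hab i)
    have hsum_le := Finset.sum_le_sum fun i (_ : i ∈ Finset.univ) => hle' i
    rcases hstrict with hne | ⟨i, hyi, hi⟩
    · refine hne ?_
      have hz0 : Finsupp.linearCombination ℕ L z = 0 := by omega
      have : z = 0 := by
        ext x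
        simp only [Finsupp.linearCombination_apply, Finsupp.sum, Finset.sum_eq_zero_iff,
          Finsupp.mem_support_iff, smul_eq_mul, mul_eq_zero, (hL _).ne', or_false] at hz0
        exact by_contra fun hx => hx (hz0 x hx)
      rw [hz, this, add_zero]
    · have := Finset.sum_lt_sum (fun i (_ : i ∈ Finset.univ) => hle' i)
        ⟨i, Finset.mem_univ i, Nat.mul_lt_mul_of_pos_left (hab' i hi) hyi⟩
      omega

theorem segL_eq_linearCombination {X : Type*} (U₁ U₂ : List X) (L : X → ℕ) (s : Seg) :
    segL U₁ U₂ L s = Finsupp.linearCombination ℕ L (segSum U₁ U₂ s) := by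
  simp [segL, segSum, map_list_sum, Function.comp_def]

/-- **Lemma (characterization of incoherent cores).**
A set of covers `C = {(A_ℓ, B_ℓ) : ℓ ∈ [N]}` is an incoherent core iff there are
`y_ℓ ∈ ℕ` with `Σ y_ℓ • U_{B_ℓ} ⊆ Σ y_ℓ • U_{A_ℓ}` in `ℕ[𝒳]`, where either the
inclusion is strict or `y_ℓ > 0` for some strict cover `(A_ℓ, B_ℓ)`. -/
theorem incoherent_core_char (U₁ U₂ : List X) (lt : BRel)
    (hbo : BoundaryOrder U₁ U₂ lt)
    (N : ℕ) (A B : Fin N → Seg)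
    (hcov : ∀ ℓ, IsCover U₁ U₂ lt (A ℓ) (B ℓ)) :
    IncoherentCore U₁ U₂ lt {p | ∃ ℓ, p = (A ℓ, B ℓ)} ↔
      ∃ y : Fin N → ℕ,
        (∑ ℓ, y ℓ • segSum U₁ U₂ (B ℓ)) ≤ (∑ ℓ, y ℓ • segSum U₁ U₂ (A ℓ)) ∧
        ((∑ ℓ, y ℓ • segSum U₁ U₂ (B ℓ)) ≠ (∑ ℓ, y ℓ • segSum U₁ U₂ (A ℓ)) ∨
          ∃ ℓ, 0 < y ℓ ∧ IsStrictCover U₁ U₂ lt (A ℓ) (B ℓ)) := by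
  rw [← not_exists_linearCombination_le_iff (fun ℓ => segSum U₁ U₂ (A ℓ))
    (fun ℓ => segSum U₁ U₂ (B ℓ)) fun ℓ => IsStrictCover U₁ U₂ lt (A ℓ) (B ℓ)]
  simp only [IncoherentCore, segL_eq_linearCombination]
  simp only [hcov, implies_true, true_and, Set.mem_ofPred_eq, forall_exists_index,
    forall_eq_apply_imp_iff]

end ExtWordEq
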